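/- Let G be a finite group whose order is a power of 2 and let V be a finite-dimensional real representation of G of odd dimension. Then either V^G ≠ 0, or there exists a subgroup H ≤ G of index 2 with V^H ≠ 0. -/

import Mathlib

/-- The eigenspaces of a linear involution for `1` and `-1` have complementary dimensions. -/
theorem LinearMap.finrank_ker_sub_one_add_finrank_ker_add_one {V : Type*} [AddCommGroup V]
    [Module ℝ V] [FiniteDimensional ℝ V] (T : V →ₗ[ℝ] V) (hT : T * T = 1) :
    Module.finrank ℝ (LinearMap.ker (T - 1)) + Module.finrank ℝ (LinearMap.ker (T + 1)) =
      Module.finrank ℝ V := by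
  have hTT : ∀ v, T (T v) = v := fun v => by
    rw [← Module.End.mul_apply, hT, Module.End.one_apply]
  have hrange : LinearMap.range (T - 1) = LinearMap.ker (T + 1) := by
    ext v
    simp only [LinearMap.mem_range, LinearMap.mem_ker, LinearMap.sub_apply, LinearMap.add_apply,
      Module.End.one_apply]
    constructor
    · rintro ⟨w, rfl⟩
      rw [map_sub, hTT]
      abel
    · intro h
      refine ⟨(-(1 / 2 : ℝ)) • v, ?_⟩
      rw [map_smul, eq_neg_of_add_eq_zero_left h]
      module
  rw [← hrange, add_comm, LinearMap.finrank_range_add_finrank_ker]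

/-- The restriction of a representation to an invariant subspace. -/
def Representation.restrictInvariant {G V : Type*} [Group G] [AddCommGroup V] [Module ℝ V]
    (ρ : G →* Module.End ℝ V) (W : Submodule ℝ V) (hW : ∀ g, ∀ v ∈ W, ρ g v ∈ W) :
    G →* Module.End ℝ W where
  toFun g := (ρ g).restrict (hW g)
  map_one' := by ext; simp
  map_mul' g h := by ext; simp

/-- A real representation of odd dimension of a finite `2`-group has a common eigenvector, with
all eigenvalues equal to `1` or `-1`. -/
theorem IsPGroup.exists_forall_eq_or_eq_neg_of_odd_finrank {G V : Type*} [Group G] [Finite G]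
    (hG : IsPGroup 2 G) [AddCommGroup V] [Module ℝ V] [FiniteDimensional ℝ V]
    (ρ : G →* Module.End ℝ V) (hodd : Odd (Module.finrank ℝ V)) :
    ∃ v : V, v ≠ 0 ∧ ∀ g, ρ g v = v ∨ ρ g v = -v := by
  induction hn : Nat.card G + Module.finrank ℝ V using Nat.strong_induction_on
    generalizing G V with
  | _ n ih =>
  have restrict_case (W : Submodule ℝ V) (hW : ∀ g, ∀ v ∈ W, ρ g v ∈ W) (hne : W ≠ ⊤)
      (hWodd : Odd (Module.finrank ℝ W)) : ∃ v : V, v ≠ 0 ∧ ∀ g, ρ g v = v ∨ ρ g v = -v := by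
    have hlt := Submodule.finrank_lt hne
    obtain ⟨v, hv, h⟩ := ih _ (by omega) hG (Representation.restrictInvariant ρ W hW) hWodd rfl
    refine ⟨v, by simpa using hv, fun g => (h g).imp (fun hg => ?_) fun hg => ?_⟩
    · exact congrArg Subtype.val hg
    · exact congrArg Subtype.val hg
  by_cases hinj : Function.Injective ρ
  swap
  · have hker : ρ.ker ≠ ⊥ := fun h => hinj ((MonoidHom.ker_eq_bot_iff ρ).1 h)
    have hcard := Subgroup.card_eq_card_quotient_mul_card_subgroup ρ.ker
    have hone := (Subgroup.one_lt_card_iff_ne_bot ρ.ker).2 hker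
    have hpos : 0 < Nat.card (G ⧸ ρ.ker) := Nat.card_pos
    have hlt : Nat.card (G ⧸ ρ.ker) < Nat.card G := by
      rw [hcard]
      exact lt_mul_of_one_lt_right hpos hone
    obtain ⟨v, hv, h⟩ := ih _ (by omega) (hG.to_quotient ρ.ker)
      (QuotientGroup.lift ρ.ker ρ fun _ => id) hodd rfl
    exact ⟨v, hv, fun g => h (g : G ⧸ ρ.ker)⟩
  rcases subsingleton_or_nontrivial G with _ | _
  · have : Nontrivial V := Module.nontrivial_of_finrank_pos hodd.pos
    obtain ⟨v, hv⟩ := exists_ne (0 : V)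
    exact ⟨v, hv, fun g => Or.inl (by simp [Subsingleton.elim g 1])⟩
  have := hG.center_nontrivial
  obtain ⟨k, hk, hcard⟩ :=
    (hG.to_subgroup (Subgroup.center G)).nontrivial_iff_card.1 inferInstance
  obtain ⟨⟨z, hz⟩, hz2⟩ := exists_prime_orderOf_dvd_card' (G := Subgroup.center G) 2
    (hcard ▸ dvd_pow_self 2 hk.ne')
  rw [Subgroup.orderOf_mk] at hz2
  have hzz : z * z = 1 := by rw [← pow_two, ← hz2, pow_orderOf_eq_one]
  have hz1 : z ≠ 1 := fun h => by simp [h] at hz2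
  have hT : ρ z * ρ z = 1 := by rw [← map_mul, hzz, map_one]
  have hT1 : ρ z ≠ 1 := fun h => hz1 (hinj (h.trans (map_one ρ).symm))
  have hcomm (g : G) (v : V) : ρ z (ρ g v) = ρ g (ρ z v) := by
    rw [← Module.End.mul_apply, ← Module.End.mul_apply, ← map_mul, ← map_mul,
      Subgroup.mem_center_iff.1 hz g]
  have hsum := LinearMap.finrank_ker_sub_one_add_finrank_ker_add_one (ρ z) hT
  rcases Nat.even_or_odd (Module.finrank ℝ (LinearMap.ker (ρ z - 1))) with hpos | hpos
  swap
  · refine restrict_case _ (fun g v hv => ?_) (fun h => hT1 ?_) hpos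
    · simp only [LinearMap.mem_ker, LinearMap.sub_apply, Module.End.one_apply] at hv ⊢
      rw [hcomm, ← map_sub, hv, map_zero]
    · exact sub_eq_zero.1 (LinearMap.ker_eq_top.1 h)
  have hneg : Odd (Module.finrank ℝ (LinearMap.ker (ρ z + 1))) := by
    rw [← hsum] at hodd
    exact (Nat.odd_add'.1 hodd).2 hpos
  by_cases htop : LinearMap.ker (ρ z + 1) = ⊤
  swap
  · refine restrict_case _ (fun g v hv => ?_) htop hneg
    simp only [LinearMap.mem_ker, LinearMap.add_apply, Module.End.one_apply] at hv ⊢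
    rw [hcomm, ← map_add, hv, map_zero]
  have hz_neg : ρ z = -1 := eq_neg_of_add_eq_zero_left (LinearMap.ker_eq_top.1 htop)
  let d : G →* ℝ := LinearMap.det.comp ρ
  have hdz : d z = -1 := by
    change LinearMap.det (ρ z) = -1
    rw [hz_neg, ← neg_one_smul ℝ (1 : Module.End ℝ V), LinearMap.det_smul, map_one, mul_one,
      hodd.neg_one_pow]
  have hd (g : G) : d g = 1 ∨ d g = -1 := by
    have hpow : d g ^ Nat.card G = 1 := by rw [← map_pow, pow_card_eq_one', map_one]
    have habs : |d g| = 1 := by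
      rw [← pow_eq_one_iff_of_nonneg (abs_nonneg _) (Nat.card_pos (α := G)).ne', ← abs_pow, hpow, abs_one]
    exact (abs_eq zero_le_one).1 habs
  have hlt : Nat.card d.ker < Nat.card G := by
    refine lt_of_le_of_ne (Subgroup.card_le_card_group _) fun h => ?_
    have hmem : z ∈ d.ker := Subgroup.eq_top_of_card_eq _ h ▸ Subgroup.mem_top z
    rw [MonoidHom.mem_ker, hdz] at hmem
    norm_num at hmem
  obtain ⟨v, hv, h⟩ := ih _ (by omega) (hG.to_subgroup d.ker) (ρ.comp d.ker.subtype) hodd rfl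
  refine ⟨v, hv, fun g => ?_⟩
  rcases hd g with hg | hg
  · exact h ⟨g, hg⟩
  · have hzg := h ⟨z * g, by rw [MonoidHom.mem_ker, map_mul, hdz, hg]; norm_num⟩
    simp only [MonoidHom.comp_apply, Subgroup.coe_subtype, map_mul, hz_neg, neg_mul, one_mul,
      LinearMap.neg_apply, neg_inj] at hzg
    exact hzg.symm.imp id neg_eq_iff_eq_neg.1

/-- Let `G` be a finite group whose order is a power of `2` and `V` a
finite-dimensional real representation of `G` of odd dimension. Then either
`V^G ≠ 0`, or there is a subgroup `H ≤ G` of index `2` with `V^H ≠ 0`. -/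
theorem stmt2 (G V : Type*) [Group G] [Fintype G]
    (hG : ∃ n : ℕ, Fintype.card G = 2 ^ n)
    [AddCommGroup V] [Module ℝ V] [FiniteDimensional ℝ V]
    [DistribMulAction G V] [SMulCommClass G ℝ V]
    (hodd : Odd (Module.finrank ℝ V)) :
    (∃ v : V, v ≠ 0 ∧ ∀ g : G, g • v = v) ∨
      ∃ H : Subgroup G, H.index = 2 ∧ ∃ v : V, v ≠ 0 ∧ ∀ h ∈ H, h • v = v := by
  obtain ⟨v, hv, h⟩ := (IsPGroup.iff_card.2 (hG.imp fun n hn => by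
    rw [Nat.card_eq_fintype_card, hn])).exists_forall_eq_or_eq_neg_of_odd_finrank
    (DistribMulAction.toModuleEnd ℝ V : G →* Module.End ℝ V) hodd
  replace h : ∀ g : G, g • v = v ∨ g • v = -v := h
  by_cases hfix : ∀ g : G, g • v = v
  · exact Or.inl ⟨v, hv, hfix⟩
  push Not at hfix
  obtain ⟨g, hg⟩ := hfix
  have horbit : MulAction.orbit G v = {v, -v} := by
    ext w
    constructor
    · rintro ⟨k, rfl⟩
      exact h k
    · rintro (rfl | rfl)
      · exact MulAction.mem_orbit_self _
      · exact ⟨g, (h g).resolve_left hg⟩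
  have hne : v ≠ -v := fun h' => hg ((h g).elim id fun h'' => h''.trans h'.symm)
  refine Or.inr ⟨MulAction.stabilizer G v, ?_, v, hv, fun k hk => hk⟩
  rw [MulAction.index_stabilizer, horbit, Set.ncard_pair hne]
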